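/- arXiv:2510.13296 — 2 statements merged into one kernel-verified Lean document; each statement's English description precedes it below -/
import Mathlib

section
/- Let n ≥ 3 and let h, h' : {0,1,…,n−1} → ℂ. Then C_m = 0 for every m = 0,1,…,2n−4 if and only if the vectors (h_0,…,h_{n−1}) and (h'_0,…,h'_{n−1}) are linearly dependent over ℂ, i.e., if and only if h_k h'_l − h'_k h_l = 0 for all k, l ∈ {0,…,n−1}. -/
/-- The coefficient `C_m` from the paper: for `n ≥ 3` and `h, h' : {0,…,n-1} → ℂ`,
`C_m = Σ_{k = max(0, m-n+2)}^{min(n-2, m)} (h_k h'_{m-k+1} - h'_k h_{m-k+1}) C(n-2,k) C(n-2,m-k)`.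
(Note `m + 2 - n` in ℕ equals `max 0 (m - n + 2)` over ℤ.) -/
noncomputable def Ccoef (n : ℕ) (h h' : ℕ → ℂ) (m : ℕ) : ℂ :=
  ∑ k ∈ Finset.Icc (m + 2 - n) (min (n - 2) m),
    (h k * h' (m - k + 1) - h' k * h (m - k + 1)) *
      ((n - 2).choose k : ℂ) * ((n - 2).choose (m - k) : ℂ)

open Polynomial in
/-- Polynomials over a field of characteristic zero with vanishing Wronskian are scalar multiples
of a common polynomial. -/
theorem Polynomial.exists_eq_C_mul_of_wronskian_eq_zero {K : Type*} [Field K] [CharZero K]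
    {f g : K[X]} (hw : wronskian f g = 0) :
    ∃ (d : K[X]) (a b : K), f = C a * d ∧ g = C b * d := by
  classical
  by_cases hg : g = 0
  · exact ⟨f, 1, 0, by simp, by simp [hg]⟩
  have hd : EuclideanDomain.gcd f g ≠ 0 := fun h => hg (EuclideanDomain.gcd_eq_zero_iff.mp h).2
  obtain ⟨a, ha⟩ := EuclideanDomain.gcd_dvd_left f g
  obtain ⟨b, hb⟩ := EuclideanDomain.gcd_dvd_right f g
  have hab : IsCoprime a b := by
    have h := EuclideanDomain.gcd_eq_gcd_ab f g
    refine ⟨EuclideanDomain.gcdA f g, EuclideanDomain.gcdB f g, mul_left_cancel₀ hd ?_⟩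
    linear_combination (-1 : K[X]) * h - EuclideanDomain.gcdA f g * ha -
      EuclideanDomain.gcdB f g * hb
  generalize EuclideanDomain.gcd f g = d at *
  have hw' : wronskian a b = 0 := by
    refine (mul_eq_zero.mp (?_ : d ^ 2 * wronskian a b = 0)).resolve_left (pow_ne_zero 2 hd)
    rw [← hw, ha, hb]
    simp only [wronskian, derivative_mul]
    ring
  obtain ⟨ha', hb'⟩ := hab.wronskian_eq_zero_iff.mp hw'
  refine ⟨d, a.coeff 0, b.coeff 0, ?_, ?_⟩
  · rw [← eq_C_of_derivative_eq_zero ha', ha, mul_comm]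
  · rw [← eq_C_of_derivative_eq_zero hb', hb, mul_comm]

open Polynomial in
/-- The polynomial `∑ k ≤ N, (N choose k) h_k X ^ k`. -/
noncomputable def binomialPoly (N : ℕ) (h : ℕ → ℂ) : ℂ[X] :=
  ∑ k ∈ Finset.range (N + 1), monomial k ((N.choose k : ℂ) * h k)

theorem coeff_binomialPoly (N : ℕ) (h : ℕ → ℂ) (k : ℕ) :
    (binomialPoly N h).coeff k = (N.choose k : ℂ) * h k := by
  simp only [binomialPoly, Polynomial.finsetSum_coeff, Polynomial.coeff_monomial,
    Finset.sum_ite_eq', Finset.mem_range]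
  split_ifs with hk
  · rfl
  · simp [Nat.choose_eq_zero_of_lt (by lia : N < k)]

theorem binomialPoly_succ (N : ℕ) (h : ℕ → ℂ) :
    binomialPoly (N + 1) h =
      binomialPoly N h + Polynomial.X * binomialPoly N (fun k => h (k + 1)) := by
  ext k
  cases k with
  | zero => simp [coeff_binomialPoly]
  | succ k =>
    simp only [Polynomial.coeff_add, Polynomial.coeff_X_mul, coeff_binomialPoly,
      Nat.choose_succ_succ', Nat.cast_add]
    ring

theorem derivative_binomialPoly_succ (N : ℕ) (h : ℕ → ℂ) :
    Polynomial.derivative (binomialPoly (N + 1) h) =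
      Polynomial.C ((N : ℂ) + 1) * binomialPoly N (fun k => h (k + 1)) := by
  ext k
  simp only [Polynomial.coeff_derivative, Polynomial.coeff_C_mul, coeff_binomialPoly]
  have := congrArg (Nat.cast : ℕ → ℂ) (Nat.add_one_mul_choose_eq N k)
  push_cast at this
  linear_combination (-h (k + 1)) * this

theorem wronskian_binomialPoly_succ (N : ℕ) (h h' : ℕ → ℂ) :
    Polynomial.wronskian (binomialPoly (N + 1) h) (binomialPoly (N + 1) h') =
      Polynomial.C ((N : ℂ) + 1) *
        (binomialPoly N h * binomialPoly N (fun k => h' (k + 1)) -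
          binomialPoly N h' * binomialPoly N (fun k => h (k + 1))) := by
  rw [Polynomial.wronskian, derivative_binomialPoly_succ, derivative_binomialPoly_succ,
    binomialPoly_succ, binomialPoly_succ]
  ring

theorem Ccoef_eq_coeff (N : ℕ) (h h' : ℕ → ℂ) (m : ℕ) :
    Ccoef (N + 2) h h' m =
      (binomialPoly N h * binomialPoly N (fun k => h' (k + 1)) -
        binomialPoly N h' * binomialPoly N (fun k => h (k + 1))).coeff m := by
  simp only [Polynomial.coeff_sub, Polynomial.coeff_mul, coeff_binomialPoly,
    Finset.Nat.sum_antidiagonal_eq_sum_range_succ_mk, ← Finset.sum_sub_distrib, Ccoef,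
    Nat.add_sub_cancel]
  refine Finset.sum_subset_zero_on_sdiff ?_ ?_ ?_
  · intro k hk
    simp only [Finset.mem_Icc, Finset.mem_range] at *
    lia
  · intro k hk
    simp only [Finset.mem_sdiff, Finset.mem_Icc, Finset.mem_range] at hk
    rcases (by lia : N < k ∨ N < m - k) with hk | hk <;> simp [Nat.choose_eq_zero_of_lt hk]
  · intro k _
    ring

theorem Ccoef_eq_zero_of_lt (N : ℕ) (h h' : ℕ → ℂ) {m : ℕ} (hm : 2 * N < m) :
    Ccoef (N + 2) h h' m = 0 := by
  rw [Ccoef, Finset.Icc_eq_empty (by lia), Finset.sum_empty]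

/-- `C_m = 0` for all `m = 0,…,2n-4` iff the vectors `(h_0,…,h_{n-1})` and
`(h'_0,…,h'_{n-1})` are linearly dependent, i.e. all 2×2 minors vanish. -/
theorem Ccoef_all_zero_iff_linearly_dependent
    (n : ℕ) (hn : 3 ≤ n) (h h' : ℕ → ℂ) :
    (∀ m ≤ 2 * n - 4, Ccoef n h h' m = 0) ↔
      ∀ k < n, ∀ l < n, h k * h' l - h' k * h l = 0 := by
  obtain ⟨N, rfl⟩ : ∃ N, n = N + 2 := ⟨n - 2, by lia⟩
  constructor
  · intro hC k hk l hl
    have hw : Polynomial.wronskian (binomialPoly (N + 1) h) (binomialPoly (N + 1) h') = 0 := by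
      rw [wronskian_binomialPoly_succ]
      convert mul_zero _
      ext m
      rw [← Ccoef_eq_coeff, Polynomial.coeff_zero]
      rcases le_or_gt m (2 * N) with hm | hm
      · exact hC m (by lia)
      · exact Ccoef_eq_zero_of_lt N h h' hm
    obtain ⟨d, a, b, ha, hb⟩ := Polynomial.exists_eq_C_mul_of_wronskian_eq_zero hw
    have hf (i : ℕ) : ((N + 1).choose i : ℂ) * h i = a * d.coeff i := by
      rw [← coeff_binomialPoly, ha, Polynomial.coeff_C_mul]
    have hg (i : ℕ) : ((N + 1).choose i : ℂ) * h' i = b * d.coeff i := by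
      rw [← coeff_binomialPoly, hb, Polynomial.coeff_C_mul]
    have hchoose {i : ℕ} (hi : i < N + 2) : ((N + 1).choose i : ℂ) ≠ 0 :=
      Nat.cast_ne_zero.mpr (Nat.choose_pos (by lia)).ne'
    refine (mul_eq_zero.mp ?_).resolve_left (mul_ne_zero (hchoose hk) (hchoose hl))
    linear_combination ((N + 1).choose l : ℂ) * h' l * hf k + a * d.coeff k * hg l -
      ((N + 1).choose l : ℂ) * h l * hg k - b * d.coeff k * hf l
  · intro hdep m _
    refine Finset.sum_eq_zero fun k hk => ?_
    rw [Finset.mem_Icc] at hk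
    rw [hdep k (by lia) (m - k + 1) (by lia), zero_mul, zero_mul]
end

section
/- Let n ≥ 3, h, h' : {0,1,…,n−1} → ℂ, α ∈ ℝ, and let ψ = Σ_{k=0}^{n−1} (h_k e₀ + h'_k e₁) ⊗ T^{n−1}_k, regarded as an element of ℂ² ⊗ ℂ² ⊗ (ℂ²)^{⊗(n−2)} (the first two factors being qubits 1 and 2). Let φ_α : ℂ² → ℂ be the linear functional with φ_α(e₀) = cos(α) and φ_α(e₁) = sin(α). Then (id_{ℂ²} ⊗ id_{ℂ²} ⊗ φ_α^{⊗(n−2)})(ψ) = b₁(α) e₀⊗e₀ + b₂(α) e₀⊗e₁ + b₃(α) e₁⊗e₀ + b₄(α) e₁⊗e₁, where b₁(α) = Σ_{k=0}^{n−2} C(n−2,k) h_k cos^{n−k−2}(α) sin^k(α), b₂(α) = Σ_{k=1}^{n−1} C(n−2,k−1) h_k cos^{n−k−1}(α) sin^{k−1}(α), b₃(α) = Σ_{k=0}^{n−2} C(n−2,k) h'_k cos^{n−k−2}(α) sin^k(α), and b₄(α) = Σ_{k=1}^{n−1} C(n−2,k−1) h'_k cos^{n−k−1}(α) sin^{k−1}(α).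 -/
/-- `b₁(α)` (and, applied to `h'`, `b₃(α)`):
`Σ_{k=0}^{n-2} C(n-2,k) g_k cos^{n-k-2}(α) sin^k(α)`. -/
noncomputable def bOdd (n : ℕ) (g : ℕ → ℂ) (α : ℝ) : ℂ :=
  ∑ k ∈ Finset.range (n - 1),
    ((n - 2).choose k : ℂ) * g k * (Real.cos α : ℂ) ^ (n - k - 2) * (Real.sin α : ℂ) ^ k

/-- `b₂(α)` (and, applied to `h'`, `b₄(α)`):
`Σ_{k=1}^{n-1} C(n-2,k-1) g_k cos^{n-k-1}(α) sin^{k-1}(α)`. -/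
noncomputable def bEven (n : ℕ) (g : ℕ → ℂ) (α : ℝ) : ℂ :=
  ∑ k ∈ Finset.Icc 1 (n - 1),
    ((n - 2).choose (k - 1) : ℂ) * g k * (Real.cos α : ℂ) ^ (n - k - 1) *
      (Real.sin α : ℂ) ^ (k - 1)

/-- The state `ψ = Σ_{k=0}^{n-1} (h_k e₀ + h'_k e₁) ⊗ T^{n-1}_k`, regarded as an element
of `ℂ² ⊗ ℂ² ⊗ (ℂ²)^{⊗(n-2)}` in the function model: the first two indices `i, j` are
qubits 1 and 2, and `x : Fin (n-2) → Fin 2` indexes the remaining qubits. The factor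
`h_k e₀ + h'_k e₁` evaluated at `i` is `h_k` if `i = 0` and `h'_k` if `i = 1`, and the
Dicke vector `T^{n-1}_k` evaluated at `(j, x)` is `1` if `j + Σ_t x_t = k`, else `0`. -/
noncomputable def nearSymSplit (n : ℕ) (h h' : ℕ → ℂ)
    (i j : Fin 2) (x : Fin (n - 2) → Fin 2) : ℂ :=
  ∑ k ∈ Finset.range n,
    (if i = 0 then h k else h' k) *
      (if ((j : ℕ) + ∑ t, ((x t : ℕ))) = k then 1 else 0)

/-- The contraction `(id ⊗ id ⊗ φ_α^{⊗(n-2)})(ψ)` where `φ_α : ℂ² → ℂ` is the linear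
functional with `φ_α(e₀) = cos α`, `φ_α(e₁) = sin α`. -/
noncomputable def contractLast (n : ℕ) (h h' : ℕ → ℂ) (α : ℝ) (i j : Fin 2) : ℂ :=
  ∑ x : Fin (n - 2) → Fin 2,
    nearSymSplit n h h' i j x *
      ∏ t, (if x t = 0 then (Real.cos α : ℂ) else (Real.sin α : ℂ))

/-- A sum over bit strings of a product state weighted by a function of the Hamming weight,
grouped by Hamming weight. -/
theorem sum_hammingWeight_mul_prod (m : ℕ) (F : ℕ → ℂ) (c s : ℂ) :
    ∑ x : Fin m → Fin 2, F (∑ t, (x t : ℕ)) * ∏ t, (if x t = 0 then c else s) =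
      ∑ k ∈ Finset.range (m + 1), (m.choose k : ℂ) * F k * c ^ (m - k) * s ^ k := by
  have hbit : ∀ a : Fin 2, (a : ℕ) = if a = 0 then 0 else 1 := by decide
  have hterm : ∀ x : Fin m → Fin 2,
      F (∑ t, (x t : ℕ)) * ∏ t, (if x t = 0 then c else s) =
        (fun k => F k * c ^ (m - k) * s ^ k) (Finset.univ.filter fun t => x t ≠ 0).card := by
    intro x
    have hcard : (Finset.univ.filter fun t => x t = 0).card =
        m - (Finset.univ.filter fun t => x t ≠ 0).card := by
      have := Finset.card_filter_add_card_filter_not (s := Finset.univ) (fun t => x t = 0)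
      rw [Finset.card_univ, Fintype.card_fin] at this
      exact Nat.eq_sub_of_add_eq this
    have hsum : ∑ t, (x t : ℕ) = (Finset.univ.filter fun t => x t ≠ 0).card := by
      rw [Finset.card_filter]
      exact Finset.sum_congr rfl fun t _ => by rw [hbit]; split_ifs <;> simp_all
    rw [hsum, Finset.prod_ite, Finset.prod_const, Finset.prod_const, hcard, ← mul_assoc]
  have hpow := Finset.sum_powerset_apply_card (fun k => F k * c ^ (m - k) * s ^ k)
    (x := (Finset.univ : Finset (Fin m)))
  rw [Finset.powerset_univ, Finset.card_univ, Fintype.card_fin] at hpow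
  rw [Finset.sum_congr rfl fun x _ => hterm x]
  trans ∑ A : Finset (Fin m), (fun k => F k * c ^ (m - k) * s ^ k) A.card
  · refine Finset.sum_bij' (fun x _ => Finset.univ.filter fun t => x t ≠ 0)
      (fun A _ t => if t ∈ A then 1 else 0) (by simp) (by simp) ?_ ?_ (fun _ _ => rfl)
    · intro x _
      funext t
      have := (show ∀ a : Fin 2, (if a ≠ 0 then (1 : Fin 2) else 0) = a by decide) (x t)
      simpa using this
    · intro A _
      ext t
      simp
  · rw [hpow]
    exact Finset.sum_congr rfl fun k _ => by rw [nsmul_eq_mul]; ring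

/-- The amplitude of `nearSymSplit` depends only on the first qubit and the total Hamming weight
of the remaining ones. -/
theorem nearSymSplit_eq (n : ℕ) (hn : 2 ≤ n) (h h' : ℕ → ℂ) (i j : Fin 2)
    (x : Fin (n - 2) → Fin 2) :
    nearSymSplit n h h' i j x =
      (if i = 0 then h else h') ((j : ℕ) + ∑ t, (x t : ℕ)) := by
  have hle : ∑ t, (x t : ℕ) ≤ n - 2 := by
    simpa using Finset.sum_le_card_nsmul Finset.univ (fun t => (x t : ℕ)) 1
      fun t _ => Nat.le_of_lt_succ (x t).isLt
  have hmem : (j : ℕ) + ∑ t, (x t : ℕ) < n := by omega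
  simp only [nearSymSplit, mul_ite, mul_one, mul_zero]
  rw [Finset.sum_ite_eq, if_pos (Finset.mem_range.2 hmem)]
  split_ifs <;> rfl

theorem contractLast_eq_sum (n : ℕ) (hn : 2 ≤ n) (h h' : ℕ → ℂ) (α : ℝ) (i j : Fin 2) :
    contractLast n h h' α i j = ∑ k ∈ Finset.range (n - 1),
      ((n - 2).choose k : ℂ) * (if i = 0 then h else h') ((j : ℕ) + k) *
        (Real.cos α : ℂ) ^ (n - 2 - k) * (Real.sin α : ℂ) ^ k := by
  simp only [contractLast, nearSymSplit_eq n hn]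
  rw [sum_hammingWeight_mul_prod (n - 2) fun k => (if i = 0 then h else h') ((j : ℕ) + k),
    show n - 2 + 1 = n - 1 by omega]

theorem contractLast_zero_right (n : ℕ) (hn : 2 ≤ n) (h h' : ℕ → ℂ) (α : ℝ) (i : Fin 2) :
    contractLast n h h' α i 0 = bOdd n (if i = 0 then h else h') α := by
  rw [contractLast_eq_sum n hn, bOdd]
  refine Finset.sum_congr rfl fun k _ => ?_
  rw [Nat.sub_right_comm, Fin.val_zero, zero_add]

theorem contractLast_one_right (n : ℕ) (hn : 2 ≤ n) (h h' : ℕ → ℂ) (α : ℝ) (i : Fin 2) :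
    contractLast n h h' α i 1 = bEven n (if i = 0 then h else h') α := by
  rw [contractLast_eq_sum n hn, bEven, ← Finset.Ico_add_one_right_eq_Icc,
    Finset.sum_Ico_eq_sum_range, Nat.add_sub_cancel]
  refine Finset.sum_congr rfl fun k _ => ?_
  rw [Nat.add_sub_cancel_left, show n - (1 + k) - 1 = n - 2 - k by omega, Fin.val_one]

/-- Contracting the last `n-2` qubits of `ψ` with `φ_α` yields
`b₁(α) e₀⊗e₀ + b₂(α) e₀⊗e₁ + b₃(α) e₁⊗e₀ + b₄(α) e₁⊗e₁`. -/
theorem contractLast_eq_b (n : ℕ) (hn : 3 ≤ n) (h h' : ℕ → ℂ) (α : ℝ) :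
    contractLast n h h' α 0 0 = bOdd n h α ∧
    contractLast n h h' α 0 1 = bEven n h α ∧
    contractLast n h h' α 1 0 = bOdd n h' α ∧
    contractLast n h h' α 1 1 = bEven n h' α := by
  have hn2 : 2 ≤ n := by omega
  exact ⟨contractLast_zero_right n hn2 h h' α 0, contractLast_one_right n hn2 h h' α 0,
    contractLast_zero_right n hn2 h h' α 1, contractLast_one_right n hn2 h h' α 1⟩
end
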